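/- arXiv:1412.5300 — 5 statements merged into one kernel-verified Lean document; each statement's English description precedes it below -/
import Mathlib

section
/- Let k be a field and F = k((t)). The set L† of Laurent series f = ∑_i f_i y^i in F((y)) for which there exist positive integers c, d such that −v_t(f_i) ≤ c·i + d for every integer i with f_i ≠ 0 is a subfield of F((y)): it contains 0 and 1 and is closed under addition, negation, multiplication, and inverses of nonzero elements. Moreover L† contains the image of the field of rational functions F(y) under the canonical embedding of F(y) into F((y)). -/
namespace LaurentSeries

variable {K : Type*} [Field K] (v : AddValuation K (WithTop ℤ))

/-- The coefficients `fᵢ` of `f` satisfy `-v(fᵢ) ≤ c * i + d`. -/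
def LinearBound (c d : ℤ) (f : LaurentSeries K) : Prop :=
  ∀ i : ℤ, ((-(c * i + d) : ℤ) : WithTop ℤ) ≤ v (f.coeff i)

variable {v}

theorem LinearBound.exists_of_le {c d c' : ℤ} {f : LaurentSeries K} (h : LinearBound v c d f)
    (hc : c ≤ c') : ∃ d₀, ∀ d', d₀ ≤ d' → LinearBound v c' d' f := by
  refine ⟨d - (c' - c) * f.order, fun d' hd' i => ?_⟩
  by_cases hi : f.coeff i = 0
  · simp [hi]
  · have := HahnSeries.order_le_of_coeff_ne_zero hi
    refine le_trans (WithTop.coe_le_coe.2 ?_) (h i)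
    nlinarith

theorem LinearBound.exists_common {c d c' d' : ℤ} {f g : LaurentSeries K}
    (hf : LinearBound v c d f) (hg : LinearBound v c' d' g) :
    ∃ a b, LinearBound v a b f ∧ LinearBound v a b g := by
  obtain ⟨b, hb⟩ := hf.exists_of_le (le_max_left c c')
  obtain ⟨b', hb'⟩ := hg.exists_of_le (le_max_right c c')
  exact ⟨_, _, hb _ (le_max_left b b'), hb' _ (le_max_right b b')⟩

theorem LinearBound.add {c d : ℤ} {f g : LaurentSeries K} (hf : LinearBound v c d f)
    (hg : LinearBound v c d g) : LinearBound v c d (f + g) :=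
  fun i => v.map_le_add (hf i) (hg i)

theorem LinearBound.neg {c d : ℤ} {f : LaurentSeries K} (hf : LinearBound v c d f) :
    LinearBound v c d (-f) := fun i => by
  rw [HahnSeries.coeff_neg, AddValuation.map_neg]
  exact hf i

theorem LinearBound.mul {c d d' : ℤ} {f g : LaurentSeries K} (hf : LinearBound v c d f)
    (hg : LinearBound v c d' g) : LinearBound v c (d + d') (f * g) := fun i => by
  rw [HahnSeries.coeff_mul]
  refine v.map_le_sum fun x hx => ?_
  have hx : x.1 + x.2 = i := (Finset.mem_antidiagonal.1 hx).2.2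
  rw [v.map_mul]
  refine le_trans ?_ (add_le_add (hf x.1) (hg x.2))
  rw [← WithTop.coe_add, WithTop.coe_le_coe, ← hx]
  exact le_of_eq (by ring)

variable (v) in
theorem exists_linearBound_single (n : ℤ) (a : K) :
    ∃ c d, LinearBound v c d (HahnSeries.single n a) := by
  by_cases ha : a = 0
  · exact ⟨0, 0, fun i => by simp [ha]⟩
  · obtain ⟨m, hm⟩ := WithTop.ne_top_iff_exists.1 (v.ne_top_iff.2 ha)
    refine ⟨0, -m, fun i => ?_⟩
    by_cases hi : i = n
    · simp [hi, ← hm]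
    · simp [HahnSeries.coeff_single_of_ne hi]

/-- If `-v(pₙ) ≤ C * n - v(p₀)` for all `n`, then the inverse of `p` satisfies the same bound. -/
theorem _root_.PowerSeries.le_addValuation_coeff_inv {p : PowerSeries K} {C m : ℤ}
    (h₀ : v (PowerSeries.constantCoeff p) = m)
    (h : ∀ n : ℕ, ((m - C * n : ℤ) : WithTop ℤ) ≤ v (PowerSeries.coeff n p)) (n : ℕ) :
    ((-m - C * n : ℤ) : WithTop ℤ) ≤ v (PowerSeries.coeff n p⁻¹) := by
  have hinv : v (PowerSeries.constantCoeff p)⁻¹ = ((-m : ℤ) : WithTop ℤ) := by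
    rw [v.map_inv, h₀]
    rfl
  induction n using Nat.strong_induction_on with
  | _ n ih =>
    rw [PowerSeries.coeff_inv]
    split_ifs with hn
    · simp [hn, hinv]
    · rw [v.map_mul, v.map_neg, hinv]
      have hsum : ((-(C * n) : ℤ) : WithTop ℤ) ≤ v (∑ x ∈ Finset.HasAntidiagonal.antidiagonal n,
          if x.2 < n then PowerSeries.coeff x.1 p * PowerSeries.coeff x.2 p⁻¹ else 0) := by
        refine v.map_le_sum fun x hx => ?_
        split_ifs with hx2
        · rw [v.map_mul]
          refine le_trans ?_ (add_le_add (h x.1) (ih x.2 hx2))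
          rw [← WithTop.coe_add, WithTop.coe_le_coe,
            ← Finset.HasAntidiagonal.mem_antidiagonal.1 hx]
          push_cast
          exact le_of_eq (by ring)
        · simp
      refine le_trans ?_ (add_le_add le_rfl hsum)
      rw [← WithTop.coe_add, WithTop.coe_le_coe, sub_eq_add_neg]

variable (v) in
/-- The subfield of Laurent series whose coefficients satisfy `-v(fᵢ) ≤ c * i + d` for
some `c` and `d`. -/
def overconvergent : Subfield (LaurentSeries K) where
  carrier := {f | ∃ c d, LinearBound v c d f}
  zero_mem' := ⟨0, 0, fun i => by simp⟩
  one_mem' := exists_linearBound_single v 0 1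
  add_mem' := by
    rintro f g ⟨c, d, hf⟩ ⟨c', d', hg⟩
    obtain ⟨a, b, hf, hg⟩ := hf.exists_common hg
    exact ⟨a, b, hf.add hg⟩
  neg_mem' := fun ⟨c, d, hf⟩ => ⟨c, d, hf.neg⟩
  mul_mem' := by
    rintro f g ⟨c, d, hf⟩ ⟨c', d', hg⟩
    obtain ⟨a, b, hf, hg⟩ := hf.exists_common hg
    exact ⟨a, b + b, hf.mul hg⟩
  inv_mem' := by
    rintro f ⟨c, d, hf⟩
    by_cases hf0 : f = 0
    · exact ⟨0, 0, fun i => by simp [hf0]⟩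
    set p := f.powerSeriesPart
    have hp0 : PowerSeries.constantCoeff p ≠ 0 := by
      rw [← PowerSeries.coeff_zero_eq_constantCoeff_apply, powerSeriesPart_coeff]
      simpa using HahnSeries.coeff_order_eq_zero.not.2 hf0
    obtain ⟨m, hm⟩ := WithTop.ne_top_iff_exists.1 (v.ne_top_iff.2 hp0)
    set e := c * f.order + d + m
    have hp (n : ℕ) : ((m - (c + |e|) * n : ℤ) : WithTop ℤ) ≤ v (PowerSeries.coeff n p) := by
      rcases n.eq_zero_or_pos with rfl | hn
      · simp [hm]
      · rw [powerSeriesPart_coeff]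
        refine le_trans (WithTop.coe_le_coe.2 ?_) (hf _)
        have hn : (1 : ℤ) ≤ n := by exact_mod_cast hn
        have he : e ≤ |e| := le_abs_self e
        have h0 : 0 ≤ |e| := abs_nonneg e
        have : c * f.order + d + m ≤ |e| := he
        nlinarith
    have hbound : LinearBound v (c + |e|) m (HahnSeries.ofPowerSeries ℤ K p⁻¹) := fun i => by
      rw [PowerSeries.coeff_coe]
      split_ifs with hi
      · simp
      · refine le_trans (WithTop.coe_le_coe.2 (le_of_eq ?_))
          (PowerSeries.le_addValuation_coeff_inv hm.symm hp i.natAbs)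
        rw [Int.natAbs_of_nonneg (not_lt.1 hi)]
        ring
    have hfinv : f⁻¹ = HahnSeries.single (-f.order) 1 * HahnSeries.ofPowerSeries ℤ K p⁻¹ := by
      refine inv_eq_of_mul_eq_one_right ?_
      nth_rw 1 [← single_order_mul_powerSeriesPart f]
      rw [mul_mul_mul_comm, HahnSeries.single_mul_single, ← map_mul,
        PowerSeries.mul_inv_cancel _ hp0]
      simp
    obtain ⟨a, b, hs⟩ := exists_linearBound_single v (-f.order) 1
    obtain ⟨a, b, hs, hb⟩ := hs.exists_common hbound
    exact ⟨a, b + b, hfinv ▸ hs.mul hb⟩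

theorem coe_ratFunc_mem_overconvergent (r : RatFunc K) :
    (r : LaurentSeries K) ∈ overconvergent v := by
  have hpoly (p : Polynomial K) :
      ((p : PowerSeries K) : LaurentSeries K) ∈ overconvergent v := by
    induction p using Polynomial.induction_on' with
    | add p q hp hq => simpa using add_mem hp hq
    | monomial n a =>
      have : (((Polynomial.monomial n a : Polynomial K) : PowerSeries K) : LaurentSeries K) =
          HahnSeries.single (n : ℤ) a := by
        rw [Polynomial.coe_monomial, PowerSeries.monomial_eq_C_mul_X_pow]
        simp
      rw [this]
      exact exists_linearBound_single v n a
  rw [← RatFunc.num_div_denom r, RatFunc.algebraMap_apply_div]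
  exact div_mem (hpoly _) (hpoly _)

theorem mem_overconvergent_addVal_iff {k : Type*} [Field k]
    {f : LaurentSeries (LaurentSeries k)} :
    f ∈ overconvergent (HahnSeries.addVal ℤ k) ↔ ∃ c d : ℤ, 0 < c ∧ 0 < d ∧
      ∀ i : ℤ, f.coeff i ≠ 0 → -(f.coeff i).order ≤ c * i + d := by
  constructor
  · rintro ⟨c, d, hf⟩
    obtain ⟨d₀, h⟩ := hf.exists_of_le (le_max_left c 1)
    refine ⟨max c 1, max d₀ 1, by simp, by simp, fun i hi => ?_⟩
    have := h _ (le_max_left d₀ 1) i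
    rw [HahnSeries.addVal_apply_of_ne hi, WithTop.coe_le_coe] at this
    linarith
  · rintro ⟨c, d, -, -, hf⟩
    refine ⟨c, d, fun i => ?_⟩
    by_cases hi : f.coeff i = 0
    · simp [hi]
    · rw [HahnSeries.addVal_apply_of_ne hi, WithTop.coe_le_coe]
      linarith [hf i hi]

end LaurentSeries


/-- Let `k` be a field and `F = k((t))`. The set of Laurent series
`f = ∑ᵢ fᵢ yⁱ ∈ F((y))` for which there exist positive integers `c, d` with
`-v_t(fᵢ) ≤ c·i + d` whenever `fᵢ ≠ 0` is a subfield of `F((y))` containing the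
rational functions `F(y)`. Here `v_t` is the `t`-adic valuation, i.e. `HahnSeries.order`. -/
theorem overconvergent_laurent_series_subfield (k : Type*) [Field k] :
    ∀ S : Set (LaurentSeries (LaurentSeries k)),
      S = {f | ∃ c d : ℤ, 0 < c ∧ 0 < d ∧
        ∀ i : ℤ, f.coeff i ≠ 0 → -(f.coeff i).order ≤ c * i + d} →
      (0 : LaurentSeries (LaurentSeries k)) ∈ S ∧
      (1 : LaurentSeries (LaurentSeries k)) ∈ S ∧
      (∀ f g, f ∈ S → g ∈ S → f + g ∈ S) ∧
      (∀ f, f ∈ S → -f ∈ S) ∧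
      (∀ f g, f ∈ S → g ∈ S → f * g ∈ S) ∧
      (∀ f, f ∈ S → f ≠ 0 → f⁻¹ ∈ S) ∧
      (∀ r : RatFunc (LaurentSeries k), (↑r : LaurentSeries (LaurentSeries k)) ∈ S) := by
  rintro S rfl
  simp only [Set.mem_ofPred_eq, ← LaurentSeries.mem_overconvergent_addVal_iff]
  exact ⟨zero_mem _, one_mem _, fun _ _ => add_mem, fun _ => neg_mem, fun _ _ => mul_mem,
    fun _ hf _ => inv_mem hf, LaurentSeries.coe_ratFunc_mem_overconvergent⟩
end

section
/- Let K be a normed field, let η₀ ∈ ℝ with 0 < η₀ < 1 and ε ∈ ℝ with 0 < ε ≤ 1, and set η = η₀^ε. Then η₀ ≤ η < 1, and for every function a : ℤ → K and all real numbers M, N ≥ 0 such that ‖a(j)‖ ≤ M and ‖a(j)‖·η₀^{min(j,0)} ≤ N for all j ∈ ℤ, one has ‖a(i)‖·η^{min(i,0)} ≤ M^{1−ε}·N^{ε} for all i ∈ ℤ. -/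
/-- (Interpolation inequality, Lemma `epsnorm`.) Let `K` be a normed
field, `0 < η₀ < 1`, `0 < ε ≤ 1`, and set `η = η₀ ^ ε`. Then `η₀ ≤ η < 1`, and for every
`a : ℤ → K` and `M, N ≥ 0` with `‖a j‖ ≤ M` and `‖a j‖ · η₀ ^ min j 0 ≤ N` for all `j`,
one has `‖a i‖ · η ^ min i 0 ≤ M ^ (1 - ε) · N ^ ε` for all `i`. -/
theorem gauss_norm_interpolation (K : Type*) [NormedField K] (η₀ ε : ℝ)
    (hη₀ : 0 < η₀) (hη₀1 : η₀ < 1) (hε0 : 0 < ε) (hε1 : ε ≤ 1) :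
    η₀ ≤ η₀ ^ ε ∧ η₀ ^ ε < 1 ∧
    ∀ (a : ℤ → K) (M N : ℝ), 0 ≤ M → 0 ≤ N →
      (∀ j : ℤ, ‖a j‖ ≤ M) →
      (∀ j : ℤ, ‖a j‖ * η₀ ^ (min j 0) ≤ N) →
      ∀ i : ℤ, ‖a i‖ * (η₀ ^ ε) ^ (min i 0) ≤ M ^ (1 - ε) * N ^ ε := by
  refine ⟨?_, Real.rpow_lt_one hη₀.le hη₀1 hε0, fun a M N hM hN haM haN i => ?_⟩
  · simpa using Real.rpow_le_rpow_of_exponent_ge hη₀ hη₀1.le hε1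
  have hη : 0 ≤ η₀ ^ (min i 0) := zpow_nonneg hη₀.le _
  have hcomm : (η₀ ^ ε) ^ (min i 0) = (η₀ ^ (min i 0)) ^ ε := by
    rw [← Real.rpow_intCast, ← Real.rpow_intCast, ← Real.rpow_mul hη₀.le,
      ← Real.rpow_mul hη₀.le, mul_comm]
  have hsplit : ‖a i‖ = ‖a i‖ ^ (1 - ε) * ‖a i‖ ^ ε := by
    rw [← Real.rpow_add' (norm_nonneg _) (by simp), sub_add_cancel, Real.rpow_one]
  calc ‖a i‖ * (η₀ ^ ε) ^ (min i 0)
      = ‖a i‖ ^ (1 - ε) * (‖a i‖ * η₀ ^ (min i 0)) ^ ε := by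
        rw [Real.mul_rpow (norm_nonneg _) hη, ← mul_assoc, ← hsplit, hcomm]
    _ ≤ M ^ (1 - ε) * N ^ ε :=
        mul_le_mul
          (Real.rpow_le_rpow (norm_nonneg _) (haM i) (sub_nonneg.2 hε1))
          (Real.rpow_le_rpow (mul_nonneg (norm_nonneg _) hη) (haN i) hε0.le)
          (Real.rpow_nonneg (mul_nonneg (norm_nonneg _) hη) _) (Real.rpow_nonneg hM _)
end

section
/- Let K be a normed field, f : ℕ → K a sequence, and k ∈ ℕ. Assume there exists ρ₁ > 1 such that ‖f(i)‖·ρ₁^i → 0 as i → ∞, and assume f has order k, i.e. ‖f(i)‖ ≤ ‖f(k)‖ for all i ≤ k and ‖f(i)‖ < ‖f(k)‖ for all i > k. Then there exists ρ₀ > 1 such that for every real ρ with 1 < ρ ≤ ρ₀ one has ‖f(i)‖·ρ^i ≤ ‖f(k)‖·ρ^k for all i ≤ k and ‖f(i)‖·ρ^i < ‖f(k)‖·ρ^k for all i > k. -/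
open Filter

/-- If `f : ℕ → K` (coefficients of an overconvergent power series over
a normed field `K`) satisfies `‖f i‖ · ρ₁ ^ i → 0` for some `ρ₁ > 1` and has order `k`
(i.e. `‖f i‖ ≤ ‖f k‖` for `i ≤ k` and `‖f i‖ < ‖f k‖` for `i > k`), then there is
`ρ₀ > 1` such that `f` has `ρ`-order `k` for every `1 < ρ ≤ ρ₀`. -/
theorem order_implies_rho_order (K : Type*) [NormedField K] (f : ℕ → K) (k : ℕ)
    (ρ₁ : ℝ) (hρ₁ : 1 < ρ₁)
    (htend : Tendsto (fun i : ℕ => ‖f i‖ * ρ₁ ^ i) atTop (nhds 0))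
    (hord₁ : ∀ i ≤ k, ‖f i‖ ≤ ‖f k‖)
    (hord₂ : ∀ i > k, ‖f i‖ < ‖f k‖) :
    ∃ ρ₀ : ℝ, 1 < ρ₀ ∧ ∀ ρ : ℝ, 1 < ρ → ρ ≤ ρ₀ →
      (∀ i ≤ k, ‖f i‖ * ρ ^ i ≤ ‖f k‖ * ρ ^ k) ∧
      (∀ i > k, ‖f i‖ * ρ ^ i < ‖f k‖ * ρ ^ k) := by
  have hk : 0 < ‖f k‖ := (norm_nonneg _).trans_lt (hord₂ (k + 1) k.lt_succ_self)
  obtain ⟨N, hN⟩ := eventually_atTop.1 (htend.eventually_lt_const hk)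
  have hfin : ∀ᶠ ρ : ℝ in nhds 1, ∀ i ∈ Finset.Ioo k N, ‖f i‖ * ρ ^ i < ‖f k‖ * ρ ^ k := by
    refine (Finset.eventually_all _).2 fun i hi => ?_
    have hl : Continuous fun ρ : ℝ => ‖f i‖ * ρ ^ i := by fun_prop
    have hr : Continuous fun ρ : ℝ => ‖f k‖ * ρ ^ k := by fun_prop
    refine hl.continuousAt.eventually_lt hr.continuousAt ?_
    simpa using hord₂ i (Finset.mem_Ioo.1 hi).1
  obtain ⟨ε, hε, hball⟩ := Metric.eventually_nhds_iff.1 hfin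
  refine ⟨min ρ₁ (1 + ε / 2), lt_min hρ₁ (by linarith), fun ρ hρ hρ₀ => ⟨fun i hi => ?_,
    fun i hi => ?_⟩⟩
  · have := hord₁ i hi
    have := hρ.le
    gcongr
  · obtain ⟨hle₁, hleε⟩ := le_min_iff.1 hρ₀
    rcases lt_or_ge i N with hiN | hiN
    · refine hball ?_ i (Finset.mem_Ioo.2 ⟨hi, hiN⟩)
      rw [Real.dist_eq, abs_of_pos (sub_pos.2 hρ)]
      linarith
    · calc ‖f i‖ * ρ ^ i ≤ ‖f i‖ * ρ₁ ^ i := by gcongr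
        _ < ‖f k‖ := hN i hiN
        _ ≤ ‖f k‖ * ρ ^ k := le_mul_of_one_le_right hk.le (one_le_pow₀ hρ.le)
end

section
/- Let K be a normed field. For a : ℤ → K and η ∈ (0,1] such that the set {‖a(j)‖·η^{min(j,0)} : j ∈ ℤ} is bounded above, write ‖a‖_η for its supremum, and write ‖a‖ := ‖a‖₁ = sup_j ‖a(j)‖. Let f : ℕ → (ℤ → K) and k ∈ ℕ. Assume: (a) there exist η₀ ∈ (0,1) and ρ₀ > 1 such that for every i the set {‖f(i)(j)‖·η₀^{min(j,0)} : j ∈ ℤ} is bounded above and ‖f(i)‖_{η₀}·ρ₀^i → 0 as i → ∞; and (b) ‖f(i)‖ ≤ ‖f(k)‖ for all i ≤ k and ‖f(i)‖ < ‖f(k)‖ for all i > k (these suprema being finite by (a)). Then there exist η with η₀ ≤ η < 1 and ρ > 1 such that ‖f(i)‖_η·ρ^i ≤ ‖f(k)‖_η·ρ^k for all i ≤ k and ‖f(i)‖_η·ρ^i < ‖f(k)‖_η·ρ^k for all i > k. -/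
open Filter

lemma one_le_zpow_min_zero {η : ℝ} (h0 : 0 < η) (h1 : η ≤ 1) (j : ℤ) :
    1 ≤ η ^ (min j 0) :=
  one_le_zpow_of_nonpos₀ h0 h1 (min_le_right j 0)

lemma zpow_min_zero_anti {η₀ η : ℝ} (h0 : 0 < η₀) (h : η₀ ≤ η) (j : ℤ) :
    η ^ (min j 0) ≤ η₀ ^ (min j 0) := by
  obtain ⟨n, hn⟩ := Int.exists_eq_neg_ofNat (min_le_right j 0)
  rw [hn, zpow_neg, zpow_neg, zpow_natCast, zpow_natCast]
  gcongr

lemma bddAbove_mul_zpow_min_zero {a : ℤ → ℝ} (ha : ∀ j, 0 ≤ a j) {η₀ η : ℝ} (h0 : 0 < η₀)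
    (h : η₀ ≤ η) (hb : BddAbove (Set.range fun j : ℤ => a j * η₀ ^ (min j 0))) :
    BddAbove (Set.range fun j : ℤ => a j * η ^ (min j 0)) :=
  hb.range_mono _ fun j => mul_le_mul_of_nonneg_left (zpow_min_zero_anti h0 h j) (ha j)

/-- Log-convexity of the Gauss norms: a geometric interpolation bound between radii
`1` and `η₀`. -/
lemma mul_zpow_min_zero_le_rpow {a A B η₀ θ : ℝ} {j : ℤ} (ha : 0 ≤ a) (h0 : 0 < η₀)
    (hA : a ≤ A) (hB : a * η₀ ^ (min j 0) ≤ B) (hθ0 : 0 < θ) (hθ1 : θ < 1) :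
    a * (η₀ ^ θ) ^ (min j 0) ≤ A ^ (1 - θ) * B ^ θ := by
  have hz : 0 ≤ η₀ ^ (min j 0) := (zpow_pos h0 _).le
  have hpow : (η₀ ^ θ) ^ (min j 0) = (η₀ ^ (min j 0)) ^ θ := by
    rw [← Real.rpow_intCast, ← Real.rpow_intCast, ← Real.rpow_mul h0.le,
      ← Real.rpow_mul h0.le, mul_comm]
  calc a * (η₀ ^ θ) ^ (min j 0) = a ^ (1 - θ) * (a * η₀ ^ (min j 0)) ^ θ := by
        rw [Real.mul_rpow ha hz, ← mul_assoc, ← Real.rpow_add' ha (by simp), hpow]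
        simp
    _ ≤ A ^ (1 - θ) * B ^ θ :=
        mul_le_mul (Real.rpow_le_rpow ha hA (by linarith))
          (Real.rpow_le_rpow (mul_nonneg ha hz) hB hθ0.le)
          (Real.rpow_nonneg (mul_nonneg ha hz) _) (Real.rpow_nonneg (ha.trans hA) _)

/-- Upper semicontinuity of the Gauss norm at radius `1`. -/
lemma eventually_iSup_mul_zpow_min_zero_lt {a : ℤ → ℝ} (ha : ∀ j, 0 ≤ a j) {η₀ c : ℝ}
    (h0 : 0 < η₀) (h1 : η₀ ≤ 1)
    (hb : BddAbove (Set.range fun j : ℤ => a j * η₀ ^ (min j 0))) (hc : (⨆ j, a j) < c) :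
    ∀ᶠ θ : ℝ in nhdsWithin 0 (Set.Ioi 0), (⨆ j, a j * (η₀ ^ θ) ^ (min j 0)) < c := by
  set A := ⨆ j, a j
  set B := (⨆ j, a j * η₀ ^ (min j 0)) + 1 with hBdef
  have hB : 0 < B := by
    have := Real.iSup_nonneg fun j => mul_nonneg (ha j) (zpow_pos h0 (min j 0)).le
    linarith
  have hbA : BddAbove (Set.range a) := by
    simpa using bddAbove_mul_zpow_min_zero ha h0 h1 hb
  have hcont : ContinuousAt (fun θ : ℝ => A ^ (1 - θ) * B ^ θ) 0 := by
    refine ContinuousAt.mul ?_ ?_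
    · exact ContinuousAt.rpow continuousAt_const (by fun_prop) (Or.inr (by norm_num))
    · exact ContinuousAt.rpow continuousAt_const continuousAt_id (Or.inl hB.ne')
  have hlt := hcont.eventually_lt (continuousAt_const (y := c)) (by simpa using hc)
  filter_upwards [hlt.filter_mono nhdsWithin_le_nhds,
    Ioo_mem_nhdsGT (zero_lt_one' ℝ)] with θ hθ hθ'
  refine lt_of_le_of_lt (ciSup_le fun j => ?_) hθ
  exact mul_zpow_min_zero_le_rpow (ha j) h0 (le_ciSup hbA j)
    ((le_ciSup hb j).trans (by rw [hBdef]; linarith)) hθ'.1 hθ'.2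

/-- Let `K` be a normed field. For `a : ℤ → K` and `η ∈ (0,1]` write
`‖a‖_η = ⨆ j, ‖a j‖ · η ^ min j 0` (a supremum of reals) and `‖a‖ = ⨆ j, ‖a j‖`.
Let `f : ℕ → (ℤ → K)` and `k : ℕ`. Assume there are `η₀ ∈ (0,1)` and `ρ₀ > 1` such that
each set `{‖f i j‖ · η₀ ^ min j 0 : j}` is bounded above and `‖f i‖_{η₀} · ρ₀ ^ i → 0`,
and that `‖f i‖ ≤ ‖f k‖` for `i ≤ k` while `‖f i‖ < ‖f k‖` for `i > k`. Then there are
`η₀ ≤ η < 1` and `ρ > 1` with `‖f i‖_η · ρ ^ i ≤ ‖f k‖_η · ρ ^ k` for `i ≤ k` and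
`‖f i‖_η · ρ ^ i < ‖f k‖_η · ρ ^ k` for `i > k`. -/
theorem order_implies_eta_rho_order (K : Type*) [NormedField K]
    (f : ℕ → ℤ → K) (k : ℕ) (η₀ ρ₀ : ℝ)
    (hη₀ : 0 < η₀) (hη₀1 : η₀ < 1) (hρ₀ : 1 < ρ₀)
    (hbdd : ∀ i : ℕ, BddAbove (Set.range fun j : ℤ => ‖f i j‖ * η₀ ^ (min j 0)))
    (htend : Tendsto (fun i : ℕ =>
      (⨆ j : ℤ, ‖f i j‖ * η₀ ^ (min j 0)) * ρ₀ ^ i) atTop (nhds 0))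
    (hord₁ : ∀ i ≤ k, (⨆ j : ℤ, ‖f i j‖) ≤ ⨆ j : ℤ, ‖f k j‖)
    (hord₂ : ∀ i > k, (⨆ j : ℤ, ‖f i j‖) < ⨆ j : ℤ, ‖f k j‖) :
    ∃ η : ℝ, η₀ ≤ η ∧ η < 1 ∧ ∃ ρ : ℝ, 1 < ρ ∧
      (∀ i ≤ k, (⨆ j : ℤ, ‖f i j‖ * η ^ (min j 0)) * ρ ^ i ≤
        (⨆ j : ℤ, ‖f k j‖ * η ^ (min j 0)) * ρ ^ k) ∧
      (∀ i > k, (⨆ j : ℤ, ‖f i j‖ * η ^ (min j 0)) * ρ ^ i <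
        (⨆ j : ℤ, ‖f k j‖ * η ^ (min j 0)) * ρ ^ k) := by
  set N : ℝ → ℕ → ℝ := fun η i => ⨆ j : ℤ, ‖f i j‖ * η ^ (min j 0) with hN
  set G : ℕ → ℝ := fun i => ⨆ j : ℤ, ‖f i j‖ with hG
  have hM : 0 < G k :=
    (Real.iSup_nonneg fun j => norm_nonneg (f (k + 1) j)).trans_lt (hord₂ (k + 1) k.lt_succ_self)
  obtain ⟨I, hI⟩ := eventually_atTop.1 (htend.eventually_lt_const hM)
  -- a radius `ρ` for which the finitely many strict inequalities beyond `k` persist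
  have hρ : ∀ᶠ ρ : ℝ in nhdsWithin 1 (Set.Ioi 1), ∀ i ∈ Finset.range I, k < i →
      G i * ρ ^ i < G k := by
    refine (Filter.eventually_all_finset _).2 fun i _ => ?_
    by_cases hi : k < i
    · have hcont : ContinuousAt (fun ρ : ℝ => G i * ρ ^ i) 1 := by fun_prop
      have := hcont.eventually_lt (continuousAt_const (y := G k)) (by simpa using hord₂ i hi)
      exact (this.filter_mono nhdsWithin_le_nhds).mono fun _ h _ => h
    · exact Eventually.of_forall fun _ h => absurd h hi
  obtain ⟨ρ, hρI, hρ1, hρρ₀⟩ := (hρ.and (Ioo_mem_nhdsGT hρ₀)).exists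
  have hρ0 : 0 < ρ := zero_lt_one.trans hρ1
  have key : ∀ i : ℕ, ∀ c : ℝ, G i * ρ ^ i < c →
      ∀ᶠ θ : ℝ in nhdsWithin 0 (Set.Ioi 0), N (η₀ ^ θ) i * ρ ^ i < c := by
    intro i c hc
    filter_upwards [eventually_iSup_mul_zpow_min_zero_lt (fun j => norm_nonneg (f i j)) hη₀
      hη₀1.le (hbdd i) ((lt_div_iff₀ (pow_pos hρ0 i)).2 hc)] with θ hθ
    exact (lt_div_iff₀ (pow_pos hρ0 i)).1 hθ
  have hlow : ∀ᶠ θ : ℝ in nhdsWithin 0 (Set.Ioi 0), ∀ i ∈ Finset.range k,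
      N (η₀ ^ θ) i * ρ ^ i < G k * ρ ^ k := by
    refine (Filter.eventually_all_finset _).2 fun i hi => key i _ ?_
    have hik := Finset.mem_range.1 hi
    calc G i * ρ ^ i ≤ G k * ρ ^ i := by gcongr; exact hord₁ i hik.le
      _ < G k * ρ ^ k := by gcongr
  have hmid : ∀ᶠ θ : ℝ in nhdsWithin 0 (Set.Ioi 0), ∀ i ∈ Finset.range I, k < i →
      N (η₀ ^ θ) i * ρ ^ i < G k := by
    refine (Filter.eventually_all_finset _).2 fun i hi => ?_
    by_cases hik : k < i
    · exact (key i _ (hρI i hi hik)).mono fun _ h _ => h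
    · exact Eventually.of_forall fun _ h => absurd h hik
  obtain ⟨θ, ⟨hθlow, hθmid⟩, hθ0, hθ1⟩ :=
    ((hlow.and hmid).and (Ioo_mem_nhdsGT (zero_lt_one' ℝ))).exists
  have hη0 : η₀ ≤ η₀ ^ θ := by
    simpa using Real.rpow_le_rpow_of_exponent_ge hη₀ hη₀1.le hθ1.le
  have hη1 : η₀ ^ θ < 1 := Real.rpow_lt_one hη₀.le hη₀1 hθ0
  have hbddη : ∀ i, BddAbove (Set.range fun j : ℤ => ‖f i j‖ * (η₀ ^ θ) ^ (min j 0)) := fun i =>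
    bddAbove_mul_zpow_min_zero (fun j => norm_nonneg (f i j)) hη₀ hη0 (hbdd i)
  have hGN : G k ≤ N (η₀ ^ θ) k := ciSup_mono (hbddη k) fun j =>
    le_mul_of_one_le_right (norm_nonneg _)
      (one_le_zpow_min_zero (hη₀.trans_le hη0) hη1.le j)
  have hGNk : G k * ρ ^ k ≤ N (η₀ ^ θ) k * ρ ^ k := by gcongr
  refine ⟨η₀ ^ θ, hη0, hη1, ρ, hρ1, fun i hi => ?_, fun i hi => ?_⟩
  · rcases hi.eq_or_lt with rfl | hi
    · exact le_rfl
    · exact (hθlow i (Finset.mem_range.2 hi)).le.trans hGNk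
  · refine lt_of_lt_of_le ?_ ((le_mul_of_one_le_right hM.le (one_le_pow₀ hρ1.le)).trans hGNk)
    rcases lt_or_ge i I with hiI | hiI
    · exact hθmid i (Finset.mem_range.2 hiI) hi
    · refine lt_of_le_of_lt ?_ (hI i hiI)
      refine mul_le_mul ?_ (pow_le_pow_left₀ hρ0.le hρρ₀.le i) (by positivity)
        (Real.iSup_nonneg fun j => mul_nonneg (norm_nonneg _) (zpow_pos hη₀ _).le)
      exact ciSup_mono (hbdd i) fun j =>
        mul_le_mul_of_nonneg_left (zpow_min_zero_anti hη₀ hη0 j) (norm_nonneg _)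
end

section
/- Let R be an integral domain which is a principal ideal domain and an algebra over ℚ, and let d : R → R be a derivation (an additive map satisfying d(ab) = a·d(b) + d(a)·b). Assume that for every irreducible element f of R, the elements f and d(f) are coprime, i.e. there exist λ, μ ∈ R with λ·f + μ·d(f) = 1. Let M be a finitely generated R-module equipped with an additive map ∇ : M → M satisfying the Leibniz rule ∇(f·m) = d(f)·m + f·∇(m) for all f ∈ R and m ∈ M. Then M is torsion-free, and hence a free R-module. -/
theorem leibniz_pow_succ {R : Type*} [CommRing R] {d : R → R}
    (hd_mul : ∀ a b : R, d (a * b) = a * d b + d a * b) (f : R) (n : ℕ) :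
    d (f ^ (n + 1)) = (n + 1 : R) * f ^ n * d f := by
  induction n with
  | zero => simp
  | succ k ih =>
    rw [pow_succ, hd_mul, ih]
    push_cast
    ring

theorem exists_pow_smul_eq_zero_of_pow_smul_eq_zero {R M : Type*} [CommRing R]
    [AddCommGroup M] [Module R M] [IsNoetherian R M] (f : R) :
    ∃ n : ℕ, ∀ (k : ℕ) (m : M), f ^ k • m = 0 → f ^ n • m = 0 := by
  let K : ℕ →o Submodule R M :=
    { toFun := fun k => LinearMap.ker (LinearMap.lsmul R M (f ^ k))
      monotone' := fun a b hab m hm => by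
        simp only [LinearMap.mem_ker, LinearMap.lsmul_apply] at hm ⊢
        rw [← Nat.sub_add_cancel hab, pow_add, mul_smul, hm, smul_zero] }
  obtain ⟨n, hn⟩ := monotone_stabilizes_iff_noetherian.mpr ‹IsNoetherian R M› K
  refine ⟨n, fun k m hm => ?_⟩
  have hk : m ∈ K (max n k) := K.monotone (le_max_right n k) hm
  rw [← hn _ (le_max_left n k)] at hk
  exact hk

/-- An element coprime to its derivative acts injectively on a Noetherian module with a
connection. -/
theorem eq_zero_of_smul_eq_zero_of_connection {R M : Type*} [CommRing R] [Algebra ℚ R]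
    [AddCommGroup M] [Module R M] [IsNoetherian R M] {d : R → R} {D : M → M}
    (hd_mul : ∀ a b : R, d (a * b) = a * d b + d a * b)
    (hD_add : ∀ m n : M, D (m + n) = D m + D n)
    (hLeib : ∀ (f : R) (m : M), D (f • m) = d f • m + f • D m)
    {f : R} (hf : ∃ a b : R, a * f + b * d f = 1) {m : M} (hm : f • m = 0) : m = 0 := by
  obtain ⟨a, b, hab⟩ := hf
  have hD_zero : D 0 = 0 := by simpa using hD_add 0 0
  have step : ∀ n : ℕ, (∀ (k : ℕ) (m : M), f ^ k • m = 0 → f ^ (n + 1) • m = 0) →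
      ∀ (k : ℕ) (m : M), f ^ k • m = 0 → f ^ n • m = 0 := by
    intro n hn k m hk
    have h0 : f ^ (n + 1) • m = 0 := hn k m hk
    have h1 : ((n + 1 : R) * f ^ n * d f) • m + f ^ (n + 1) • D m = 0 := by
      rw [← leibniz_pow_succ hd_mul, ← hLeib, h0, hD_zero]
    have h2 : f ^ (n + 1) • D m = 0 := by
      apply hn (n + 2)
      have h := congrArg (f • ·) h1
      simp only [smul_add, smul_zero, smul_smul] at h
      rw [show f * ((n + 1 : R) * f ^ n * d f) = ((n + 1 : R) * d f) * f ^ (n + 1) by ring,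
        mul_smul, h0, smul_zero, zero_add] at h
      rwa [show f ^ (n + 2) = f * f ^ (n + 1) by ring]
    rw [h2, add_zero] at h1
    obtain ⟨c, hc⟩ : ∃ c : R, c * (n + 1 : R) = 1 := by
      refine ⟨algebraMap ℚ R ((n + 1 : ℚ)⁻¹), ?_⟩
      have h : (n + 1 : ℚ) ≠ 0 := by positivity
      rw [show (n + 1 : R) = algebraMap ℚ R (n + 1 : ℚ) by simp, ← map_mul,
        inv_mul_cancel₀ h, map_one]
    have key : f ^ n = a * f ^ (n + 1) + (b * c) * ((n + 1 : R) * f ^ n * d f) := by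
      linear_combination (-f ^ n) * hab - b * f ^ n * d f * hc
    rw [key, add_smul, mul_smul, mul_smul (b * c), h0, h1, smul_zero, smul_zero, add_zero]
  have descend : ∀ n : ℕ, (∀ (k : ℕ) (m : M), f ^ k • m = 0 → f ^ n • m = 0) →
      ∀ (k : ℕ) (m : M), f ^ k • m = 0 → f ^ 0 • m = 0 := by
    intro n
    induction n with
    | zero => exact id
    | succ n ih => exact fun h => ih (step n h)
  obtain ⟨n, hn⟩ := exists_pow_smul_eq_zero_of_pow_smul_eq_zero (M := M) f
  simpa using descend n hn 1 m (by simpa using hm)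


/-- (Abstract content of Lemma 2.5 of the paper.) Let `R` be a PID
containing `ℚ` with a derivation `d : R → R` such that every irreducible `f ∈ R` is
coprime to `d f` (i.e. `λ·f + μ·d f = 1` for some `λ, μ`). Then every finitely
generated `R`-module `M` carrying a connection `D` (an additive map satisfying the
Leibniz rule `D (f • m) = d f • m + f • D m`) is torsion-free, hence free. -/
theorem module_with_connection_free (R : Type*) [CommRing R] [IsDomain R]
    [IsPrincipalIdealRing R] [Algebra ℚ R]
    (d : R → R)
    (hd_add : ∀ a b : R, d (a + b) = d a + d b)
    (hd_mul : ∀ a b : R, d (a * b) = a * d b + d a * b)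
    (hcop : ∀ f : R, Irreducible f → ∃ lam mu : R, lam * f + mu * d f = 1)
    (M : Type*) [AddCommGroup M] [Module R M] [Module.Finite R M]
    (D : M → M)
    (hD_add : ∀ m n : M, D (m + n) = D m + D n)
    (hLeib : ∀ (f : R) (m : M), D (f • m) = d f • m + f • D m) :
    (∀ (r : R) (m : M), r • m = 0 → r = 0 ∨ m = 0) ∧ Module.Free R M := by
  have torsion_free : ∀ r : R, r ≠ 0 → ∀ m : M, r • m = 0 → m = 0 := by
    intro r
    induction r using WfDvdMonoid.induction_on_irreducible with
    | zero => exact fun h => absurd rfl h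
    | unit u hu => exact fun _ m hm => hu.smul_eq_zero.mp hm
    | mul a i ha hi ih =>
      intro _ m hm
      rw [mul_smul] at hm
      exact ih ha m (eq_zero_of_smul_eq_zero_of_connection hd_mul hD_add hLeib (hcop i hi) hm)
  have smul_eq_zero' : ∀ (r : R) (m : M), r • m = 0 → r = 0 ∨ m = 0 := fun r m h =>
    or_iff_not_imp_left.mpr fun hr => torsion_free r hr m h
  have : Module.IsTorsionFree R M := .of_smul_eq_zero smul_eq_zero'
  exact ⟨smul_eq_zero', inferInstance⟩
end
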